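/- arXiv:2303.02942 — 2 statements merged into one kernel-verified Lean document; each statement's English description precedes it below -/
import Mathlib

section
/- For every integer n ≥ 4 and all p_A, p_B ∈ [0,1] with p_A + p_B > 0, the first-serving team's advantage under modified rally scoring is a symmetric function of the two rally-win probabilities: f*_n(p_A, p_B) = f*_n(p_B, p_A). -/
/-- The serving team in modified rally scoring. -/
inductive MRSrv : Type
  | A | B
  deriving DecidableEq

/-- States of a modified rally scoring game to `n`: a (capped) score `(i, j)` together
with the serving team, or one of the two absorbing states. -/
inductive MRState (n : ℕ) : Type
  | game (i j : ℕ) (srv : MRSrv)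
  | Awins
  | Bwins
  deriving DecidableEq

/-- The capped scores of a game to `n`: both scores at most `n - 1`, or one of the two
advantage scores `(n - 1, n)`, `(n, n - 1)`. -/
def validScore (n i j : ℕ) : Prop :=
  (i ≤ n - 1 ∧ j ≤ n - 1) ∨ (i = n - 1 ∧ j = n) ∨ (i = n ∧ j = n - 1)

/-- Result of Team A scoring a point from (capped) score `(i, j)`; Team A serves next. -/
def mrScoreA (n i j : ℕ) : MRState n :=
  if i = n - 1 then
    if j = n - 1 then MRState.game n (n - 1) MRSrv.A
    else if j = n then MRState.game (n - 1) (n - 1) MRSrv.A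
    else MRState.Awins
  else if i = n then MRState.Awins
  else MRState.game (i + 1) j MRSrv.A

/-- Result of Team B scoring a point from (capped) score `(i, j)`; Team B serves next. -/
def mrScoreB (n i j : ℕ) : MRState n :=
  if j = n - 1 then
    if i = n - 1 then MRState.game (n - 1) n MRSrv.B
    else if i = n then MRState.game (n - 1) (n - 1) MRSrv.B
    else MRState.Bwins
  else if j = n then MRState.Bwins
  else MRState.game i (j + 1) MRSrv.B

/-- Under modified-rally point awarding, whether Team A, winning a rally as the
*receiving* team at capped score `(i, j)`, is awarded a point: it must not yet have
reached `n - 1` points, and it must not be the case that the opponent has reached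
`n - 1` points while Team A has reached `n - 3` points. -/
def canRecvScoreA (n i j : ℕ) : Prop := i < n - 1 ∧ ¬(n - 1 ≤ j ∧ n - 3 ≤ i)

/-- Whether Team B, winning a rally as the receiving team at capped score `(i, j)`,
is awarded a point. -/
def canRecvScoreB (n i j : ℕ) : Prop := j < n - 1 ∧ ¬(n - 1 ≤ i ∧ n - 3 ≤ j)

instance (n i j : ℕ) : Decidable (canRecvScoreA n i j) := by
  unfold canRecvScoreA; infer_instance

instance (n i j : ℕ) : Decidable (canRecvScoreB n i j) := by
  unfold canRecvScoreB; infer_instance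

/-- `mrDist n pA pB k s t` : the probability that a modified rally scoring game to `n`
is in state `t` after `k` rallies, starting from state `s`.  The serving team wins the
rally with probability `pA` (resp. `pB`); the winner of the rally serves next; the
winner always scores when it was serving, and scores when it was receiving exactly
when permitted by the modified-rally rules. The absorbing states stay put. -/
def mrDist (n : ℕ) (pA pB : ℝ) : ℕ → MRState n → MRState n → ℝ
  | 0, s, t => if t = s then 1 else 0
  | k + 1, MRState.Awins, t => mrDist n pA pB k MRState.Awins t
  | k + 1, MRState.Bwins, t => mrDist n pA pB k MRState.Bwins t
  | k + 1, MRState.game i j MRSrv.A, t =>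
      pA * mrDist n pA pB k (mrScoreA n i j) t
        + (1 - pA) * mrDist n pA pB k
            (if canRecvScoreB n i j then mrScoreB n i j else MRState.game i j MRSrv.B) t
  | k + 1, MRState.game i j MRSrv.B, t =>
      pB * mrDist n pA pB k (mrScoreB n i j) t
        + (1 - pB) * mrDist n pA pB k
            (if canRecvScoreA n i j then mrScoreA n i j else MRState.game i j MRSrv.A) t

/-- Probability that Team A eventually wins the modified rally scoring game, from `s`. -/
noncomputable def mrWinA (n : ℕ) (pA pB : ℝ) (s : MRState n) : ℝ :=
  ⨆ k : ℕ, mrDist n pA pB k s MRState.Awins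

/-- Probability that Team B eventually wins the modified rally scoring game, from `s`. -/
noncomputable def mrWinB (n : ℕ) (pA pB : ℝ) (s : MRState n) : ℝ :=
  ⨆ k : ℕ, mrDist n pA pB k s MRState.Bwins

/-- The first-serving team's advantage `f*_n(p_A, p_B)` under modified rally scoring:
P(Team A wins | Team A serves first) − P(Team A wins | Team B serves first). -/
noncomputable def mrAdv (n : ℕ) (pA pB : ℝ) : ℝ :=
  mrWinA n pA pB (MRState.game 0 0 MRSrv.A) - mrWinA n pA pB (MRState.game 0 0 MRSrv.B)

open Filter Topology

/-- Relabelling the two teams. -/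
def MRSrv.swap : MRSrv → MRSrv
  | .A => .B
  | .B => .A

/-- The state obtained by relabelling the two teams. -/
def MRState.swap {n : ℕ} : MRState n → MRState n
  | .game i j s => .game j i s.swap
  | .Awins => .Bwins
  | .Bwins => .Awins

theorem MRState.swap_swap {n : ℕ} (s : MRState n) : s.swap.swap = s := by
  rcases s with ⟨i, j, _ | _⟩ | _ | _ <;> rfl

theorem MRState.swap_inj {n : ℕ} {s t : MRState n} : s.swap = t.swap ↔ s = t :=
  ⟨fun h => by rw [← s.swap_swap, h, t.swap_swap], fun h => h ▸ rfl⟩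

theorem swap_mrScoreA (n i j : ℕ) : (mrScoreA n i j).swap = mrScoreB n j i := by
  unfold mrScoreA mrScoreB
  split_ifs <;> rfl

theorem swap_mrScoreB (n i j : ℕ) : (mrScoreB n i j).swap = mrScoreA n j i := by
  rw [← swap_mrScoreA, MRState.swap_swap]

theorem mrDist_swap (n : ℕ) (pA pB : ℝ) (k : ℕ) (s t : MRState n) :
    mrDist n pB pA k s.swap t.swap = mrDist n pA pB k s t := by
  induction k generalizing s with
  | zero => simp only [mrDist, MRState.swap_inj]
  | succ k ih =>
    rcases s with ⟨i, j, _ | _⟩ | _ | _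
    · simp only [mrDist, ← ih, swap_mrScoreA, apply_ite MRState.swap, swap_mrScoreB]
      rfl
    · simp only [mrDist, ← ih, swap_mrScoreB, apply_ite MRState.swap, swap_mrScoreA]
      rfl
    · exact ih .Awins
    · exact ih .Bwins

theorem mrWinA_swap (n : ℕ) (pA pB : ℝ) (s : MRState n) :
    mrWinA n pB pA s.swap = mrWinB n pA pB s :=
  iSup_congr fun k => mrDist_swap n pA pB k s .Bwins

section Limit

variable {n : ℕ} {pA pB : ℝ}

theorem mrDist_mem_Icc (hA : pA ∈ Set.Icc (0 : ℝ) 1) (hB : pB ∈ Set.Icc (0 : ℝ) 1)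
    (k : ℕ) (s t : MRState n) : mrDist n pA pB k s t ∈ Set.Icc (0 : ℝ) 1 := by
  induction k generalizing s with
  | zero => unfold mrDist; split_ifs <;> simp
  | succ k ih =>
    rcases s with ⟨i, j, _ | _⟩ | _ | _
    · exact convex_Icc (0 : ℝ) 1 (ih _) (ih _) hA.1 (sub_nonneg.2 hA.2) (by ring)
    · exact convex_Icc (0 : ℝ) 1 (ih _) (ih _) hB.1 (sub_nonneg.2 hB.2) (by ring)
    · exact ih .Awins
    · exact ih .Bwins

theorem mrDist_Awins (k : ℕ) (t : MRState n) :
    mrDist n pA pB k .Awins t = if t = .Awins then 1 else 0 := by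
  induction k with
  | zero => rfl
  | succ k ih => exact ih

theorem mrDist_Bwins (k : ℕ) (t : MRState n) :
    mrDist n pA pB k .Bwins t = if t = .Bwins then 1 else 0 := by
  induction k with
  | zero => rfl
  | succ k ih => exact ih

theorem mrDist_monotone (hA : pA ∈ Set.Icc (0 : ℝ) 1) (hB : pB ∈ Set.Icc (0 : ℝ) 1)
    (s : MRState n) {t : MRState n} (ht : t = .Awins ∨ t = .Bwins) :
    Monotone fun k => mrDist n pA pB k s t := by
  refine monotone_nat_of_le_succ fun k => ?_
  induction k generalizing s with
  | zero =>
    rcases s with ⟨i, j, r⟩ | _ | _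
    · have h : mrDist n pA pB 0 (.game i j r) t = 0 := by
        rcases ht with rfl | rfl <;> simp [mrDist]
      exact h.trans_le (mrDist_mem_Icc hA hB _ _ _).1
    · exact le_rfl
    · exact le_rfl
  | succ k ih =>
    rcases s with ⟨i, j, _ | _⟩ | _ | _
    · exact add_le_add (mul_le_mul_of_nonneg_left (ih _) hA.1)
        (mul_le_mul_of_nonneg_left (ih _) (sub_nonneg.2 hA.2))
    · exact add_le_add (mul_le_mul_of_nonneg_left (ih _) hB.1)
        (mul_le_mul_of_nonneg_left (ih _) (sub_nonneg.2 hB.2))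
    · exact le_rfl
    · exact le_rfl

theorem tendsto_mrDist (hA : pA ∈ Set.Icc (0 : ℝ) 1) (hB : pB ∈ Set.Icc (0 : ℝ) 1)
    (s : MRState n) {t : MRState n} (ht : t = .Awins ∨ t = .Bwins) :
    Tendsto (fun k => mrDist n pA pB k s t) atTop (𝓝 (⨆ k, mrDist n pA pB k s t)) :=
  tendsto_atTop_ciSup (mrDist_monotone hA hB s ht)
    ⟨1, by rintro _ ⟨k, rfl⟩; exact (mrDist_mem_Icc hA hB k s t).2⟩

/-- A function on states that is harmonic for the game chain. -/
structure IsMRHarmonic (n : ℕ) (pA pB : ℝ) (U : MRState n → ℝ) : Prop where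
  serveA (i j : ℕ) : U (.game i j .A) = pA * U (mrScoreA n i j)
    + (1 - pA) * U (if canRecvScoreB n i j then mrScoreB n i j else .game i j .B)
  serveB (i j : ℕ) : U (.game i j .B) = pB * U (mrScoreB n i j)
    + (1 - pB) * U (if canRecvScoreA n i j then mrScoreA n i j else .game i j .A)

theorem isMRHarmonic_iSup (hA : pA ∈ Set.Icc (0 : ℝ) 1) (hB : pB ∈ Set.Icc (0 : ℝ) 1)
    {t : MRState n} (ht : t = .Awins ∨ t = .Bwins) :
    IsMRHarmonic n pA pB fun s => ⨆ k, mrDist n pA pB k s t where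
  serveA i j := tendsto_nhds_unique
    ((tendsto_mrDist hA hB (.game i j .A) ht).comp (tendsto_add_atTop_nat 1))
    (((tendsto_mrDist hA hB _ ht).const_mul pA).add
      ((tendsto_mrDist hA hB _ ht).const_mul (1 - pA)))
  serveB i j := tendsto_nhds_unique
    ((tendsto_mrDist hA hB (.game i j .B) ht).comp (tendsto_add_atTop_nat 1))
    (((tendsto_mrDist hA hB _ ht).const_mul pB).add
      ((tendsto_mrDist hA hB _ ht).const_mul (1 - pB)))

theorem isMRHarmonic_one_sub_win (hA : pA ∈ Set.Icc (0 : ℝ) 1) (hB : pB ∈ Set.Icc (0 : ℝ) 1) :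
    IsMRHarmonic n pA pB fun s => 1 - mrWinA n pA pB s - mrWinB n pA pB s where
  serveA i j := by
    have h₁ := (isMRHarmonic_iSup (n := n) hA hB (.inl rfl)).serveA i j
    have h₂ := (isMRHarmonic_iSup (n := n) hA hB (.inr rfl)).serveA i j
    simp only [mrWinA, mrWinB]
    linear_combination -h₁ - h₂
  serveB i j := by
    have h₁ := (isMRHarmonic_iSup (n := n) hA hB (.inl rfl)).serveB i j
    have h₂ := (isMRHarmonic_iSup (n := n) hA hB (.inr rfl)).serveB i j
    simp only [mrWinA, mrWinB]
    linear_combination -h₁ - h₂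

end Limit

section Harmonic

variable {n : ℕ} {pA pB : ℝ} {U : MRState n → ℝ}

theorem add_sub_mul_pos (hA : pA ∈ Set.Icc (0 : ℝ) 1) (hB : pB ∈ Set.Icc (0 : ℝ) 1)
    (hpos : 0 < pA + pB) : 0 < pA + pB - pA * pB := by
  obtain ⟨hA0, hA1⟩ := hA
  obtain ⟨hB0, hB1⟩ := hB
  rcases hA0.eq_or_lt with rfl | h
  · linarith
  · nlinarith [mul_nonneg hB0 (sub_nonneg.2 hA1)]

theorem IsMRHarmonic.eq_zero_of_score (hU : IsMRHarmonic n pA pB U)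
    (hA : pA ∈ Set.Icc (0 : ℝ) 1) (hB : pB ∈ Set.Icc (0 : ℝ) 1) (hpos : 0 < pA + pB)
    {i j : ℕ} (hi : U (mrScoreA n i j) = 0) (hj : U (mrScoreB n i j) = 0) (r : MRSrv) :
    U (.game i j r) = 0 := by
  have h₁ := hU.serveA i j
  have h₂ := hU.serveB i j
  have hd := (add_sub_mul_pos hA hB hpos).ne'
  rw [apply_ite U, hi, hj] at h₁ h₂
  have key : U (.game i j .A) = 0 ∧ U (.game i j .B) = 0 := by
    split_ifs at h₁ h₂
    · constructor <;> linarith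
    · have h : U (.game i j .A) = 0 := by linarith
      exact ⟨h, by rw [h₂, h]; ring⟩
    · have h : U (.game i j .B) = 0 := by linarith
      exact ⟨by rw [h₁, h]; ring, h⟩
    · constructor
      · refine (mul_eq_zero.1 ?_).resolve_left hd
        linear_combination h₁ + (1 - pA) * h₂
      · refine (mul_eq_zero.1 ?_).resolve_left hd
        linear_combination h₂ + (1 - pB) * h₁
  cases r
  exacts [key.1, key.2]

theorem IsMRHarmonic.deuce_eq_zero (hU : IsMRHarmonic n pA pB U)
    (hA : pA ∈ Set.Icc (0 : ℝ) 1) (hB : pB ∈ Set.Icc (0 : ℝ) 1) (hpos : 0 < pA + pB)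
    (hn : 1 ≤ n) (hUA : U .Awins = 0) (hUB : U .Bwins = 0) (r : MRSrv) :
    U (.game (n - 1) (n - 1) r) = 0 := by
  have hne : n ≠ n - 1 := by omega
  have hx₁ := hU.serveA (n - 1) (n - 1)
  have hx₂ := hU.serveB (n - 1) (n - 1)
  have hy₁ := hU.serveA n (n - 1)
  have hy₂ := hU.serveB n (n - 1)
  have hz₁ := hU.serveA (n - 1) n
  have hz₂ := hU.serveB (n - 1) n
  simp [mrScoreA, mrScoreB, canRecvScoreA, canRecvScoreB, hne, hUA, hUB]
    at hx₁ hx₂ hy₁ hy₂ hz₁ hz₂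
  have hd := add_sub_mul_pos hA hB hpos
  suffices key : U (.game (n - 1) (n - 1) .A) = 0 ∧ U (.game (n - 1) (n - 1) .B) = 0 by
    cases r
    exacts [key.1, key.2]
  clear hU
  generalize U (.game (n - 1) (n - 1) .A) = xA at *
  generalize U (.game (n - 1) (n - 1) .B) = xB at *
  generalize U (.game n (n - 1) .A) = yA at *
  generalize U (.game n (n - 1) .B) = yB at *
  generalize U (.game (n - 1) n .A) = zA at *
  generalize U (.game (n - 1) n .B) = zB at *
  have hy : (pA + pB - pA * pB) * yA = (1 - pA) * pB * xB := by
    linear_combination hy₁ + (1 - pA) * hy₂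
  have hz : (pA + pB - pA * pB) * zB = (1 - pB) * pA * xA := by
    linear_combination hz₂ + (1 - pB) * hz₁
  have hxA : (pA + pB - pA * pB) * xA = (1 - pA) * (pA + pB) * xB := by
    linear_combination (pA + pB - pA * pB) * hx₁ + pA * hy
  have hxB : (pA + pB - pA * pB) * xB = (1 - pB) * (pA + pB) * xA := by
    linear_combination (pA + pB - pA * pB) * hx₂ + pB * hz
  have hE : 0 < (1 - pA) * pB ^ 2 * (pA + pB) + pA ^ 2 * (pA + pB - pA * pB) := by
    have h1 : 0 ≤ 1 - pA := sub_nonneg.2 hA.2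
    rcases hA.1.eq_or_lt with h | h
    · have hB0 : 0 < pB := by linarith
      simp only [← h]
      ring_nf
      positivity
    · positivity
  constructor
  · refine (mul_eq_zero.1 ?_).resolve_left hE.ne'
    linear_combination (pA + pB - pA * pB) * hxA + (1 - pA) * (pA + pB) * hxB
  · refine (mul_eq_zero.1 ?_).resolve_left hE.ne'
    linear_combination (pA + pB - pA * pB) * hxB + (1 - pB) * (pA + pB) * hxA

theorem IsMRHarmonic.eq_zero (hU : IsMRHarmonic n pA pB U)
    (hA : pA ∈ Set.Icc (0 : ℝ) 1) (hB : pB ∈ Set.Icc (0 : ℝ) 1) (hpos : 0 < pA + pB)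
    (hUA : U .Awins = 0) (hUB : U .Bwins = 0) {i j : ℕ} (hi : i < n) (hj : j < n) (r : MRSrv) :
    U (.game i j r) = 0 := by
  by_cases hij : i = n - 1 ∧ j = n - 1
  · obtain ⟨rfl, rfl⟩ := hij
    exact hU.deuce_eq_zero hA hB hpos (by omega) hUA hUB r
  · refine hU.eq_zero_of_score hA hB hpos ?_ ?_ r
    · unfold mrScoreA
      split_ifs <;> first | exact hUA | omega |
        exact hU.eq_zero hA hB hpos hUA hUB (by omega) hj .A
    · unfold mrScoreB
      split_ifs <;> first | exact hUB | omega |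
        exact hU.eq_zero hA hB hpos hUA hUB hi (by omega) .B
termination_by 2 * n - i - j

end Harmonic

theorem mrWinA_add_mrWinB {n : ℕ} {pA pB : ℝ} (hA : pA ∈ Set.Icc (0 : ℝ) 1)
    (hB : pB ∈ Set.Icc (0 : ℝ) 1) (hpos : 0 < pA + pB) {i j : ℕ} (hi : i < n) (hj : j < n)
    (r : MRSrv) : mrWinA n pA pB (.game i j r) + mrWinB n pA pB (.game i j r) = 1 := by
  have h := (isMRHarmonic_one_sub_win (n := n) hA hB).eq_zero hA hB hpos
    (by simp [mrWinA, mrWinB, mrDist_Awins]) (by simp [mrWinA, mrWinB, mrDist_Bwins]) hi hj r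
  linarith

/-- For every integer `n ≥ 4` and all `p_A, p_B ∈ [0,1]` with
`p_A + p_B > 0`, the first-serving team's advantage under modified rally scoring is a
symmetric function of the two rally-win probabilities. -/
theorem mrAdv_symm (n : ℕ) (hn : 4 ≤ n) (pA pB : ℝ)
    (hA : pA ∈ Set.Icc (0 : ℝ) 1) (hB : pB ∈ Set.Icc (0 : ℝ) 1)
    (hpos : 0 < pA + pB) :
    mrAdv n pA pB = mrAdv n pB pA := by
  have hsA := mrWinA_swap n pA pB (.game 0 0 .A)
  have hsB := mrWinA_swap n pA pB (.game 0 0 .B)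
  have hwA := mrWinA_add_mrWinB (n := n) hA hB hpos (i := 0) (j := 0) (by omega) (by omega) .A
  have hwB := mrWinA_add_mrWinB (n := n) hA hB hpos (i := 0) (j := 0) (by omega) (by omega) .B
  simp only [MRState.swap, MRSrv.swap] at hsA hsB
  unfold mrAdv
  linarith
end

section
/- For every x ∈ [0.34, 0.54], f_11(x, x) < 0; that is, in a side-out scoring game to 11 between evenly matched teams whose serve-win probability lies in [0.34, 0.54], the first-serving team has a strictly smaller probability of winning than the second-serving team. -/
/-- The four server designations in side-out scoring: Team A's first and second
servers and Team B's first and second servers. -/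
inductive SOSrv : Type
  | A1 | A2 | B1 | B2
  deriving DecidableEq

/-- States of a game to `n` with four server designations: a (capped) score `(i, j)`
together with a server designation, or one of the two absorbing states. -/
inductive SOState (n : ℕ) : Type
  | game (i j : ℕ) (srv : SOSrv)
  | Awins
  | Bwins
  deriving DecidableEq

/-- Result of Team A scoring a point from (capped) score `(i, j)`, with server `srv`:
from deuce `(n-1, n-1)` to advantage `(n, n-1)`; from Team B's advantage `(n-1, n)`
back to deuce; from advantage `(n, n-1)` or from `(n-1, j)` with `j ≤ n-2`, Team A wins;
otherwise the score is incremented. -/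
def soScoreA (n i j : ℕ) (srv : SOSrv) : SOState n :=
  if i = n - 1 then
    if j = n - 1 then SOState.game n (n - 1) srv
    else if j = n then SOState.game (n - 1) (n - 1) srv
    else SOState.Awins
  else if i = n then SOState.Awins
  else SOState.game (i + 1) j srv

/-- Result of Team B scoring a point from (capped) score `(i, j)`, with server `srv`. -/
def soScoreB (n i j : ℕ) (srv : SOSrv) : SOState n :=
  if j = n - 1 then
    if i = n - 1 then SOState.game (n - 1) n srv
    else if i = n then SOState.game (n - 1) (n - 1) srv
    else SOState.Bwins
  else if j = n then SOState.Bwins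
  else SOState.game i (j + 1) srv

/-- `soDist n pA pB k s t` : the probability that a side-out scoring game to `n` is in
state `t` after `k` rallies, starting from state `s`.  When Team A serves it wins the
rally with probability `pA` (scoring a point and keeping the server); otherwise the
server designation advances `A1 → A2 → B1 → B2 → A1` (side out after two faults;
the game starts with the first-serving team's second server).  Similarly for Team B
with `pB`.  The absorbing states stay put. -/
def soDist (n : ℕ) (pA pB : ℝ) : ℕ → SOState n → SOState n → ℝ
  | 0, s, t => if t = s then 1 else 0
  | k + 1, SOState.Awins, t => soDist n pA pB k SOState.Awins t
  | k + 1, SOState.Bwins, t => soDist n pA pB k SOState.Bwins t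
  | k + 1, SOState.game i j SOSrv.A1, t =>
      pA * soDist n pA pB k (soScoreA n i j SOSrv.A1) t
        + (1 - pA) * soDist n pA pB k (SOState.game i j SOSrv.A2) t
  | k + 1, SOState.game i j SOSrv.A2, t =>
      pA * soDist n pA pB k (soScoreA n i j SOSrv.A2) t
        + (1 - pA) * soDist n pA pB k (SOState.game i j SOSrv.B1) t
  | k + 1, SOState.game i j SOSrv.B1, t =>
      pB * soDist n pA pB k (soScoreB n i j SOSrv.B1) t
        + (1 - pB) * soDist n pA pB k (SOState.game i j SOSrv.B2) t
  | k + 1, SOState.game i j SOSrv.B2, t =>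
      pB * soDist n pA pB k (soScoreB n i j SOSrv.B2) t
        + (1 - pB) * soDist n pA pB k (SOState.game i j SOSrv.A1) t

/-- Probability that Team A eventually wins the side-out scoring game, from state `s`. -/
noncomputable def soWinA (n : ℕ) (pA pB : ℝ) (s : SOState n) : ℝ :=
  ⨆ k : ℕ, soDist n pA pB k s SOState.Awins

/-- Probability that Team B eventually wins the side-out scoring game, from state `s`. -/
noncomputable def soWinB (n : ℕ) (pA pB : ℝ) (s : SOState n) : ℝ :=
  ⨆ k : ℕ, soDist n pA pB k s SOState.Bwins

/-- The first-serving team's advantage `f_n(p_A, p_B)` under side-out scoring to `n`: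
P(Team A wins | Team A serves first) − P(Team A wins | Team B serves first).
The game starts at score 0-0 with the first-serving team's second server. -/
noncomputable def soAdv (n : ℕ) (pA pB : ℝ) : ℝ :=
  soWinA n pA pB (SOState.game 0 0 SOSrv.A2) - soWinA n pA pB (SOState.game 0 0 SOSrv.B2)

open Filter Topology

section FirstStep

variable {n : ℕ} {pA pB : ℝ}

theorem soDist_mem_Icc (hA : pA ∈ Set.Icc (0 : ℝ) 1) (hB : pB ∈ Set.Icc (0 : ℝ) 1) (k : ℕ)
    (s t : SOState n) : soDist n pA pB k s t ∈ Set.Icc (0 : ℝ) 1 := by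
  obtain ⟨hA0, hA1⟩ := hA
  obtain ⟨hB0, hB1⟩ := hB
  have mix : ∀ p a b : ℝ, 0 ≤ p → p ≤ 1 → a ∈ Set.Icc (0 : ℝ) 1 → b ∈ Set.Icc (0 : ℝ) 1 →
      p * a + (1 - p) * b ∈ Set.Icc (0 : ℝ) 1 := fun p a b hp hp' ha hb =>
    convex_Icc (0 : ℝ) 1 ha hb hp (sub_nonneg.2 hp') (by ring)
  induction k generalizing s with
  | zero =>
    unfold soDist
    split_ifs <;> simp
  | succ k ih =>
    rcases s with ⟨i, j, _ | _ | _ | _⟩ | _ | _ <;> unfold soDist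
    · exact mix _ _ _ hA0 hA1 (ih _) (ih _)
    · exact mix _ _ _ hA0 hA1 (ih _) (ih _)
    · exact mix _ _ _ hB0 hB1 (ih _) (ih _)
    · exact mix _ _ _ hB0 hB1 (ih _) (ih _)
    · exact ih _
    · exact ih _

theorem soDist_Awins_self (k : ℕ) : soDist n pA pB k SOState.Awins SOState.Awins = 1 := by
  induction k with
  | zero => simp [soDist]
  | succ k ih => simpa [soDist] using ih

theorem soDist_Bwins_Awins (k : ℕ) : soDist n pA pB k SOState.Bwins SOState.Awins = 0 := by
  induction k with
  | zero => simp [soDist]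
  | succ k ih => simpa [soDist] using ih

theorem soDist_Awins_monotone (hA : pA ∈ Set.Icc (0 : ℝ) 1) (hB : pB ∈ Set.Icc (0 : ℝ) 1)
    (s : SOState n) : Monotone fun k => soDist n pA pB k s SOState.Awins := by
  refine monotone_nat_of_le_succ fun k => ?_
  induction k generalizing s with
  | zero =>
    by_cases hs : s = SOState.Awins
    · subst hs
      simp only [soDist_Awins_self, le_refl]
    · have h0 : soDist n pA pB 0 s SOState.Awins = 0 := by
        simp [soDist, Ne.symm hs]
      rw [h0]
      exact (soDist_mem_Icc hA hB _ _ _).1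
  | succ k ih =>
    have hA' := sub_nonneg.2 hA.2
    have hB' := sub_nonneg.2 hB.2
    have hA0 := hA.1
    have hB0 := hB.1
    rcases s with ⟨i, j, _ | _ | _ | _⟩ | _ | _
    · rw [soDist, soDist]; gcongr <;> exact ih _
    · rw [soDist, soDist]; gcongr <;> exact ih _
    · rw [soDist, soDist]; gcongr <;> exact ih _
    · rw [soDist, soDist]; gcongr <;> exact ih _
    · simp only [soDist_Awins_self, le_refl]
    · simp only [soDist_Bwins_Awins, le_refl]

theorem tendsto_soDist_soWinA (hA : pA ∈ Set.Icc (0 : ℝ) 1) (hB : pB ∈ Set.Icc (0 : ℝ) 1)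
    (s : SOState n) :
    Tendsto (fun k => soDist n pA pB k s SOState.Awins) atTop (𝓝 (soWinA n pA pB s)) :=
  tendsto_atTop_ciSup (soDist_Awins_monotone hA hB s)
    ⟨1, by rintro _ ⟨k, rfl⟩; exact (soDist_mem_Icc hA hB k s _).2⟩

theorem soWinA_Awins : soWinA n pA pB SOState.Awins = 1 := by
  simp [soWinA, soDist_Awins_self]

theorem soWinA_Bwins : soWinA n pA pB SOState.Bwins = 0 := by
  simp [soWinA, soDist_Bwins_Awins]

theorem soWinA_eq_of_soDist_succ (hA : pA ∈ Set.Icc (0 : ℝ) 1) (hB : pB ∈ Set.Icc (0 : ℝ) 1)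
    {s t u : SOState n} {p : ℝ}
    (h : ∀ k, soDist n pA pB (k + 1) s SOState.Awins =
      p * soDist n pA pB k t SOState.Awins + (1 - p) * soDist n pA pB k u SOState.Awins) :
    soWinA n pA pB s = p * soWinA n pA pB t + (1 - p) * soWinA n pA pB u := by
  have h1 := (tendsto_add_atTop_iff_nat 1).2 (tendsto_soDist_soWinA hA hB s)
  simp only [h] at h1
  exact tendsto_nhds_unique h1
    (((tendsto_soDist_soWinA hA hB t).const_mul p).add
      ((tendsto_soDist_soWinA hA hB u).const_mul (1 - p)))

end FirstStep

/-- The sum `1 + q + q² + q³` of the weights of the four consecutive servers. -/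
def serveSum (q : ℝ) : ℝ := 1 + q + q ^ 2 + q ^ 3

theorem serveSum_pos {q : ℝ} (hq : 0 < q) : 0 < serveSum q := by
  unfold serveSum; positivity

/-- Probabilities that Team A wins, seen from the four server designations. -/
structure ServerVals where
  (a1 a2 b1 b2 : ℝ)

/-- Values at a score from the values `w` after a point of A and `v` after a point of B,
cleared of the denominator `serveSum q`. -/
def IsServeStep (q : ℝ) (u w v : ServerVals) : Prop :=
  serveSum q * u.a1 = w.a1 + q * w.a2 + q ^ 2 * v.b1 + q ^ 3 * v.b2 ∧
  serveSum q * u.a2 = w.a2 + q * v.b1 + q ^ 2 * v.b2 + q ^ 3 * w.a1 ∧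
  serveSum q * u.b1 = v.b1 + q * v.b2 + q ^ 2 * w.a1 + q ^ 3 * w.a2 ∧
  serveSum q * u.b2 = v.b2 + q * w.a1 + q ^ 2 * w.a2 + q ^ 3 * v.b1

theorem isServeStep_of_rally {q : ℝ} (hq : q ≠ 1) {u w v : ServerVals}
    (h1 : u.a1 = (1 - q) * w.a1 + q * u.a2) (h2 : u.a2 = (1 - q) * w.a2 + q * u.b1)
    (h3 : u.b1 = (1 - q) * v.b1 + q * u.b2) (h4 : u.b2 = (1 - q) * v.b2 + q * u.a1) :
    IsServeStep q u w v := by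
  have hx : 1 - q ≠ 0 := sub_ne_zero.2 hq.symm
  unfold IsServeStep serveSum
  refine ⟨?_, ?_, ?_, ?_⟩ <;> apply mul_left_cancel₀ hx
  · linear_combination h1 + q * h2 + q ^ 2 * h3 + q ^ 3 * h4
  · linear_combination h2 + q * h3 + q ^ 2 * h4 + q ^ 3 * h1
  · linear_combination h3 + q * h4 + q ^ 2 * h1 + q ^ 3 * h2
  · linear_combination h4 + q * h1 + q ^ 2 * h2 + q ^ 3 * h3

/-- The values of a state function over the four server designations. -/
def serverVals (f : SOSrv → ℝ) : ServerVals := ⟨f .A1, f .A2, f .B1, f .B2⟩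

theorem isServeStep_soWinA {n : ℕ} {q : ℝ} (h0 : 0 ≤ q) (h1 : q < 1) (i j : ℕ) :
    IsServeStep q (serverVals fun s => soWinA n (1 - q) (1 - q) (.game i j s))
      (serverVals fun s => soWinA n (1 - q) (1 - q) (soScoreA n i j s))
      (serverVals fun s => soWinA n (1 - q) (1 - q) (soScoreB n i j s)) := by
  have hp : 1 - q ∈ Set.Icc (0 : ℝ) 1 := ⟨by linarith, by linarith⟩
  have mix : ∀ a b : ℝ, (1 - q) * a + q * b = (1 - q) * a + (1 - (1 - q)) * b :=
    fun a b => by ring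
  refine isServeStep_of_rally h1.ne ?_ ?_ ?_ ?_ <;>
    exact (soWinA_eq_of_soDist_succ hp hp fun k => by rw [soDist]).trans (mix _ _).symm

section Deuce

/-- The common denominator of the winning probabilities at deuce. -/
def deuceDen (q : ℝ) : ℝ := 1 + q + 5 * q ^ 2 - q ^ 3 + 2 * q ^ 5

theorem deuceDen_pos {q : ℝ} (h0 : 0 < q) (h1 : q < 1) : 0 < deuceDen q := by
  unfold deuceDen
  have : 0 < q ^ 2 * (1 - q) := mul_pos (by positivity) (by linarith)
  have : 0 < q ^ 5 := by positivity
  nlinarith [sq_nonneg q]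

/-- Winning probabilities at deuce `g`, from the equations at deuce, at A's advantage `h`
and at B's advantage `l`. -/
theorem deuce_values {q : ℝ} (h0 : 0 < q) {g h l : ServerVals}
    (hg : IsServeStep q g h l) (hh : IsServeStep q h ⟨1, 1, 1, 1⟩ g)
    (hl : IsServeStep q l g ⟨0, 0, 0, 0⟩) :
    2 * deuceDen q * g.a1 = 2 + 2 * q + 4 * q ^ 2 - 4 * q ^ 3 + 4 * q ^ 4 ∧
    2 * deuceDen q * g.a2 = 2 - 2 * q + 8 * q ^ 2 - 2 * q ^ 3 + 2 * q ^ 5 ∧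
    2 * deuceDen q * g.b1 = 6 * q ^ 2 + 2 * q ^ 3 - 4 * q ^ 4 + 4 * q ^ 5 ∧
    2 * deuceDen q * g.b2 = 4 * q + 2 * q ^ 2 + 2 * q ^ 5 := by
  obtain ⟨hg1, hg2, hg3, hg4⟩ := hg
  obtain ⟨hh1, hh2, -, -⟩ := hh
  obtain ⟨-, -, hl3, hl4⟩ := hl
  obtain ⟨a1, a2, b1, b2⟩ := g
  obtain ⟨c1, c2, _, _⟩ := h
  obtain ⟨_, _, l3, l4⟩ := l
  have hS : serveSum q ≠ 0 := (serveSum_pos h0).ne'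
  simp only at *
  have hsum : a1 + b1 + q * (a2 + b2) = 1 + q := by
    have hc : (1 + q ^ 2) * (1 + 2 * q - q ^ 2 + 2 * q ^ 3) ≠ 0 := by
      have : 0 < 1 + 2 * q - q ^ 2 + 2 * q ^ 3 := by
        nlinarith [mul_pos h0 h0, mul_pos h0 (mul_pos h0 h0),
          mul_nonneg h0.le (sq_nonneg (1 - q))]
      positivity
    apply mul_left_cancel₀ hc
    unfold serveSum at *
    linear_combination (1 + q + q ^ 2 + q ^ 3) * (hg1 + hg3 + q * (hg2 + hg4))
      + (1 + q ^ 2) * ((1 + q ^ 2) * (hh1 + hl3) + 2 * q * (hh2 + hl4))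
  have hm1 : c1 + l3 = 1 := by
    apply mul_left_cancel₀ hS
    unfold serveSum at *
    linear_combination hh1 + hl3 + q ^ 2 * hsum
  have hm2 : c2 + l4 = 1 := by
    apply mul_left_cancel₀ hS
    unfold serveSum at *
    linear_combination hh2 + hl4 + q * hsum
  have ha1 : a1 + b1 = 1 := by
    apply mul_left_cancel₀ hS
    unfold serveSum at *
    linear_combination hg1 + hg3 + (1 + q ^ 2) * (hm1 + q * hm2)
  have ha2 : a2 + b2 = 1 := by
    apply mul_left_cancel₀ hS
    unfold serveSum at *
    linear_combination hg2 + hg4 + (1 + q ^ 2) * (hm2 + q * hm1)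
  obtain rfl : b1 = 1 - a1 := by linarith
  obtain rfl : b2 = 1 - a2 := by linarith
  obtain rfl : l3 = 1 - c1 := by linarith
  obtain rfl : l4 = 1 - c2 := by linarith
  have e1 : serveSum q * (1 + q ^ 2) * (2 * a1 - 1) = (1 - q) * (1 + 2 * q + q ^ 4
      - 2 * q ^ 2 * (2 * a1 - 1 + q * (2 * a2 - 1))) := by
    apply mul_left_cancel₀ hS
    unfold serveSum at *
    linear_combination 2 * (1 + q ^ 2) * (1 + q + q ^ 2 + q ^ 3) * hg1
      + 2 * (1 + q ^ 2) * (1 - q ^ 2) * (hh1 + q * hh2)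
  have e2 : serveSum q * (1 + q ^ 2) * (2 * a2 - 1) = (1 - q) * ((1 - q) * (1 - q ^ 2)
      - q * (1 - q ^ 2) * (2 * a1 - 1 + q * (2 * a2 - 1))) := by
    apply mul_left_cancel₀ hS
    unfold serveSum at *
    linear_combination 2 * (1 + q ^ 2) * (1 + q + q ^ 2 + q ^ 3) * hg2
      + 2 * (1 + q ^ 2) * (1 - q ^ 2) * (hh2 - q * hh1)
  have e3 : deuceDen q * (2 * a1 - 1 + q * (2 * a2 - 1)) =
      (1 - q) * (1 + 3 * q - q ^ 2 - q ^ 3 + 2 * q ^ 4) := by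
    unfold deuceDen serveSum at *
    linear_combination e1 + q * e2
  have hS2 : serveSum q * (1 + q ^ 2) ≠ 0 := mul_ne_zero hS (by positivity)
  have d1 : deuceDen q * (2 * a1 - 1) =
      1 + q - q ^ 2 - 3 * q ^ 3 + 4 * q ^ 4 - 2 * q ^ 5 := by
    apply mul_left_cancel₀ hS2
    unfold deuceDen serveSum at *
    linear_combination (1 + q + 5 * q ^ 2 - q ^ 3 + 2 * q ^ 5) * e1
      - (1 - q) * 2 * q ^ 2 * e3
  have d2 : deuceDen q * (2 * a2 - 1) = 1 - 3 * q + 3 * q ^ 2 - q ^ 3 := by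
    apply mul_left_cancel₀ hS2
    unfold deuceDen serveSum at *
    linear_combination (1 + q + 5 * q ^ 2 - q ^ 3 + 2 * q ^ 5) * e2
      - (1 - q) * q * (1 - q ^ 2) * e3
  unfold deuceDen at *
  refine ⟨?_, ?_, ?_, ?_⟩
  · linear_combination d1
  · linear_combination d2
  · linear_combination -d1
  · linear_combination -d2

end Deuce

section IntPoly

/-- Evaluation of an integer polynomial, given by its coefficients from degree `0` up. -/
def polyEval (x : ℝ) : List ℤ → ℝ
  | [] => 0
  | a :: l => a + x * polyEval x l

def polyAdd : List ℤ → List ℤ → List ℤ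
  | [], m => m
  | a :: l, [] => a :: l
  | a :: l, b :: m => (a + b) :: polyAdd l m

def polySmul (c : ℤ) (l : List ℤ) : List ℤ := l.map (c * ·)

/-- `a + X b + X² c + X³ d`. -/
def polyMix (a b c d : List ℤ) : List ℤ :=
  polyAdd a (0 :: polyAdd b (0 :: polyAdd c (0 :: d)))

/-- Multiplication by the linear polynomial `a + b X`. -/
def polyMulLinear (a b : ℤ) (l : List ℤ) : List ℤ :=
  polyAdd (polySmul a l) (0 :: polySmul b l)

/-- For `l` of length `d`, the pair of polynomials in `t` obtained from
`(1 + t) ^ d * l ((a + b t) / (c (1 + t)))` and `(1 + t) ^ d` on multiplication by `c ^ d`. -/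
def polyMobius (a b c : ℤ) : List ℤ → List ℤ × List ℤ
  | [] => ([], [1])
  | e :: l =>
    let r := polyMobius a b c l
    (polyAdd (polySmul e (polyMulLinear c c r.2)) (polyMulLinear a b r.1),
      polyMulLinear c c r.2)

variable (x : ℝ)

@[simp]
theorem polyEval_polyAdd (l m : List ℤ) :
    polyEval x (polyAdd l m) = polyEval x l + polyEval x m := by
  induction l generalizing m with
  | nil => simp [polyAdd, polyEval]
  | cons a l ih =>
    cases m with
    | nil => simp [polyAdd, polyEval]
    | cons b m =>
      simp only [polyAdd, polyEval, ih, Int.cast_add]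
      ring

@[simp]
theorem polyEval_polySmul (c : ℤ) (l : List ℤ) :
    polyEval x (polySmul c l) = c * polyEval x l := by
  induction l with
  | nil => simp [polySmul, polyEval]
  | cons a l ih =>
    simp only [polySmul, List.map_cons, polyEval, Int.cast_mul] at ih ⊢
    rw [ih]
    ring

theorem polyEval_polyMix (a b c d : List ℤ) :
    polyEval x (polyMix a b c d) =
      polyEval x a + x * polyEval x b + x ^ 2 * polyEval x c + x ^ 3 * polyEval x d := by
  simp only [polyMix, polyEval_polyAdd, polyEval, Int.cast_zero]
  ring

@[simp]
theorem polyEval_polyMulLinear (a b : ℤ) (l : List ℤ) :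
    polyEval x (polyMulLinear a b l) = (a + b * x) * polyEval x l := by
  simp only [polyMulLinear, polyEval_polyAdd, polyEval, polyEval_polySmul, Int.cast_zero]
  ring

theorem polyEval_polyMobius {a b c : ℤ} {t y : ℝ} (h : (c + c * t) * y = a + b * t)
    (l : List ℤ) :
    polyEval t (polyMobius a b c l).2 = (c + c * t) ^ l.length ∧
    polyEval t (polyMobius a b c l).1 = (c + c * t) ^ l.length * polyEval y l := by
  induction l with
  | nil => simp [polyMobius, polyEval]
  | cons e l ih =>
    simp only [polyMobius, polyEval_polyAdd, polyEval_polySmul, polyEval_polyMulLinear, ih.1,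
      ih.2, polyEval, List.length_cons, ← h]
    constructor <;> ring

theorem polyEval_nonpos {t : ℝ} (ht : 0 ≤ t) {l : List ℤ} (h : ∀ a ∈ l, a < 0) :
    polyEval t l ≤ 0 := by
  induction l with
  | nil => simp [polyEval]
  | cons a l ih =>
    have h1 : (a : ℝ) < 0 := by exact_mod_cast h a (by simp)
    have h2 := mul_nonpos_of_nonneg_of_nonpos ht (ih fun b hb => h b (by simp [hb]))
    simp only [polyEval]
    linarith

theorem polyEval_neg {t : ℝ} (ht : 0 ≤ t) {l : List ℤ} (hl : l ≠ []) (h : ∀ a ∈ l, a < 0) :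
    polyEval t l < 0 := by
  cases l with
  | nil => exact absurd rfl hl
  | cons a l =>
    have h1 : (a : ℝ) < 0 := by exact_mod_cast h a (by simp)
    have h2 := mul_nonpos_of_nonneg_of_nonpos ht
      (polyEval_nonpos ht fun b hb => h b (List.mem_cons_of_mem _ hb))
    simp only [polyEval]
    linarith

end IntPoly

section Table

/-- Numerators of the winning probabilities of Team A for the four server designations. -/
structure ServerPolys where
  (a1 a2 b1 b2 : List ℤ)

def ServerPolys.const (l : List ℤ) : ServerPolys := ⟨l, l, l, l⟩

def serveStepPolys (w v : ServerPolys) : ServerPolys :=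
  ⟨polyMix w.a1 w.a2 v.b1 v.b2, polyMix w.a2 v.b1 v.b2 w.a1,
    polyMix v.b1 v.b2 w.a1 w.a2, polyMix v.b2 w.a1 w.a2 v.b1⟩

/-- The row of the table following the row `l`, where `v` is the entry before its first. -/
def scanRow : List ServerPolys → ServerPolys → List ServerPolys
  | [], _ => []
  | w :: l, v => serveStepPolys w v :: scanRow l (serveStepPolys w v)

def deucePolys : ServerPolys :=
  ⟨[2, 2, 4, -4, 4], [2, -2, 8, -2, 0, 2], [0, 0, 6, 2, -4, 4], [0, 4, 2, 0, 0, 2]⟩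

/-- The constants `serveSum ^ j * (2 deuceDen)`, for `r` consecutive exponents. -/
def winRow : ℕ → List ℤ → List ServerPolys
  | 0, _ => []
  | r + 1, l => ServerPolys.const l :: winRow r (polyMix l l l l)

/-- Row `m` contains the numerators when A needs `m + 1` and B needs `1, …, 11` points. -/
def polyRow : ℕ → List ServerPolys
  | 0 => deucePolys :: scanRow (winRow 10 [2, 2, 10, -2, 0, 4]) deucePolys
  | m + 1 => scanRow (polyRow m) (ServerPolys.const [])

/-- Numerator of the first-serving team's advantage in the game to 11. -/
def advantagePoly : List ℤ :=
  let p := (polyRow 10).getD 10 (ServerPolys.const [])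
  polyAdd p.a2 (polySmul (-1) p.b2)

variable (q : ℝ)

/-- Probability that A wins the game to 11 when A needs `M` and B needs `K` points. -/
noncomputable def needVals (M K : ℕ) : ServerVals :=
  if M = 0 then ⟨1, 1, 1, 1⟩ else if K = 0 then ⟨0, 0, 0, 0⟩ else
    serverVals fun s => soWinA 11 (1 - q) (1 - q) (.game (11 - M) (11 - K) s)

theorem isServeStep_needVals (h0 : 0 ≤ q) (h1 : q < 1) {M K : ℕ} (hM : M + 1 ≤ 11)
    (hK : K + 1 ≤ 11) (hMK : M ≠ 0 ∨ K ≠ 0) :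
    IsServeStep q (needVals q (M + 1) (K + 1)) (needVals q M (K + 1))
      (needVals q (M + 1) K) := by
  have hA : needVals q M (K + 1) = serverVals fun s =>
      soWinA 11 (1 - q) (1 - q) (soScoreA 11 (11 - (M + 1)) (11 - (K + 1)) s) := by
    rcases Nat.eq_zero_or_pos M with rfl | hM0
    · have h : ∀ s, soScoreA 11 (11 - (0 + 1)) (11 - (K + 1)) s = SOState.Awins := fun s => by
        unfold soScoreA
        rw [if_pos (by omega), if_neg (by omega), if_neg (by omega)]
      simp only [h, soWinA_Awins]
      simp [needVals, serverVals]
    · have h : ∀ s, soScoreA 11 (11 - (M + 1)) (11 - (K + 1)) s =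
          SOState.game (11 - M) (11 - (K + 1)) s := fun s => by
        unfold soScoreA
        rw [if_neg (by omega), if_neg (by omega), show 11 - (M + 1) + 1 = 11 - M by omega]
      simp only [h]
      simp [needVals, hM0.ne']
  have hB : needVals q (M + 1) K = serverVals fun s =>
      soWinA 11 (1 - q) (1 - q) (soScoreB 11 (11 - (M + 1)) (11 - (K + 1)) s) := by
    rcases Nat.eq_zero_or_pos K with rfl | hK0
    · have h : ∀ s, soScoreB 11 (11 - (M + 1)) (11 - (0 + 1)) s = SOState.Bwins := fun s => by
        unfold soScoreB
        rw [if_pos (by omega), if_neg (by omega), if_neg (by omega)]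
      simp only [h, soWinA_Bwins]
      simp [needVals, serverVals]
    · have h : ∀ s, soScoreB 11 (11 - (M + 1)) (11 - (K + 1)) s =
          SOState.game (11 - (M + 1)) (11 - K) s := fun s => by
        unfold soScoreB
        rw [if_neg (by omega), if_neg (by omega), show 11 - (K + 1) + 1 = 11 - K by omega]
      simp only [h]
      simp [needVals, hK0.ne']
  rw [hA, hB]
  simpa [needVals] using isServeStep_soWinA h0 h1 (11 - (M + 1)) (11 - (K + 1))

/-- `p` consists of the numerators of `needVals q M K` over
`serveSum ^ (M + K - 2) * (2 deuceDen)`. -/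
def Represents (p : ServerPolys) (M K : ℕ) : Prop :=
  let c := serveSum q ^ (M + K) * (2 * deuceDen q)
  serveSum q ^ 2 * polyEval q p.a1 = c * (needVals q M K).a1 ∧
  serveSum q ^ 2 * polyEval q p.a2 = c * (needVals q M K).a2 ∧
  serveSum q ^ 2 * polyEval q p.b1 = c * (needVals q M K).b1 ∧
  serveSum q ^ 2 * polyEval q p.b2 = c * (needVals q M K).b2

def RowRepresents (M : ℕ) : ℕ → List ServerPolys → Prop
  | _, [] => True
  | K, p :: l => Represents q p M K ∧ RowRepresents M (K + 1) l

variable {q}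

theorem RowRepresents.getD {M : ℕ} {l : List ServerPolys} {K : ℕ} (h : RowRepresents q M K l)
    {i : ℕ} (hi : i < l.length) (d : ServerPolys) : Represents q (l.getD i d) M (K + i) := by
  induction l generalizing K i with
  | nil => simp at hi
  | cons p l ih =>
    cases i with
    | zero => simpa using h.1
    | succ i =>
      have := ih h.2 (i := i) (by simpa using hi)
      rw [List.getD_cons_succ, show K + (i + 1) = K + 1 + i by ring]
      exact this

theorem Represents.serveStep {w v : ServerPolys} {M K : ℕ}
    (h : IsServeStep q (needVals q (M + 1) (K + 1)) (needVals q M (K + 1))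
      (needVals q (M + 1) K))
    (hw : Represents q w M (K + 1)) (hv : Represents q v (M + 1) K) :
    Represents q (serveStepPolys w v) (M + 1) (K + 1) := by
  obtain ⟨h1, h2, h3, h4⟩ := h
  obtain ⟨w1, w2, -, -⟩ := hw
  obtain ⟨-, -, v3, v4⟩ := hv
  rw [show M + 1 + K = M + (K + 1) by ring] at v3 v4
  unfold Represents
  simp only [serveStepPolys, polyEval_polyMix]
  rw [show M + 1 + (K + 1) = M + (K + 1) + 1 by ring, pow_succ _ (M + (K + 1))]
  generalize serveSum q ^ (M + (K + 1)) = c at *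
  refine ⟨?_, ?_, ?_, ?_⟩
  · linear_combination w1 + q * w2 + q ^ 2 * v3 + q ^ 3 * v4 - c * (2 * deuceDen q) * h1
  · linear_combination w2 + q * v3 + q ^ 2 * v4 + q ^ 3 * w1 - c * (2 * deuceDen q) * h2
  · linear_combination v3 + q * v4 + q ^ 2 * w1 + q ^ 3 * w2 - c * (2 * deuceDen q) * h3
  · linear_combination v4 + q * w1 + q ^ 2 * w2 + q ^ 3 * v3 - c * (2 * deuceDen q) * h4

theorem RowRepresents.scanRow (h0 : 0 ≤ q) (h1 : q < 1) {M : ℕ} (hM : M + 1 ≤ 11)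
    {l : List ServerPolys} {v : ServerPolys} {K : ℕ} (hMK : M ≠ 0 ∨ K ≠ 0)
    (hK : K + l.length ≤ 11) (hl : RowRepresents q M (K + 1) l)
    (hv : Represents q v (M + 1) K) :
    RowRepresents q (M + 1) (K + 1) (scanRow l v) := by
  induction l generalizing K v with
  | nil => trivial
  | cons w l ih =>
    rw [List.length_cons] at hK
    have hu := Represents.serveStep
      (isServeStep_needVals q h0 h1 hM (by omega) hMK) hl.1 hv
    exact ⟨hu, ih (Or.inr (by omega)) (by omega) hl.2 hu⟩

theorem represents_deucePolys (h0 : 0 < q) (h1 : q < 1) : Represents q deucePolys 1 1 := by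
  have hg : IsServeStep q (needVals q 1 1)
      (serverVals fun s => soWinA 11 (1 - q) (1 - q) (.game 11 10 s))
      (serverVals fun s => soWinA 11 (1 - q) (1 - q) (.game 10 11 s)) := by
    simpa [needVals, soScoreA, soScoreB] using isServeStep_soWinA (n := 11) h0.le h1 10 10
  have hh : IsServeStep q (serverVals fun s => soWinA 11 (1 - q) (1 - q) (.game 11 10 s))
      ⟨1, 1, 1, 1⟩ (needVals q 1 1) := by
    simpa [needVals, soScoreA, soScoreB, soWinA_Awins, serverVals] using
      isServeStep_soWinA (n := 11) h0.le h1 11 10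
  have hl : IsServeStep q (serverVals fun s => soWinA 11 (1 - q) (1 - q) (.game 10 11 s))
      (needVals q 1 1) ⟨0, 0, 0, 0⟩ := by
    simpa [needVals, soScoreA, soScoreB, soWinA_Bwins, serverVals] using
      isServeStep_soWinA (n := 11) h0.le h1 10 11
  obtain ⟨g1, g2, g3, g4⟩ := deuce_values h0 hg hh hl
  unfold Represents
  simp only [deucePolys, polyEval, mul_assoc, Nat.reduceAdd] at *
  rw [g1, g2, g3, g4]
  push_cast
  refine ⟨?_, ?_, ?_, ?_⟩ <;> ring

theorem rowRepresents_winRow (r : ℕ) {K : ℕ} {l : List ℤ}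
    (hl : serveSum q ^ 2 * polyEval q l = serveSum q ^ K * (2 * deuceDen q)) :
    RowRepresents q 0 K (winRow r l) := by
  induction r generalizing K l with
  | zero => trivial
  | succ r ih =>
    refine ⟨by simp [Represents, ServerPolys.const, needVals, hl], ih ?_⟩
    rw [polyEval_polyMix, pow_succ]
    unfold serveSum at *
    linear_combination (1 + q + q ^ 2 + q ^ 3) * hl

@[simp]
theorem length_scanRow (l : List ServerPolys) (v : ServerPolys) :
    (scanRow l v).length = l.length := by
  induction l generalizing v with
  | nil => rfl
  | cons w l ih => simp [scanRow, ih]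

@[simp]
theorem length_winRow (r : ℕ) (l : List ℤ) : (winRow r l).length = r := by
  induction r generalizing l with
  | zero => rfl
  | succ r ih => simp [winRow, ih]

@[simp]
theorem length_polyRow (m : ℕ) : (polyRow m).length = 11 := by
  induction m with
  | zero => simp [polyRow]
  | succ m ih => simp [polyRow, ih]

theorem rowRepresents_polyRow (h0 : 0 < q) (h1 : q < 1) {m : ℕ} (hm : m + 1 ≤ 11) :
    RowRepresents q (m + 1) 1 (polyRow m) := by
  induction m with
  | zero =>
    refine ⟨represents_deucePolys h0 h1, RowRepresents.scanRow h0.le h1 hm (Or.inr one_ne_zero)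
      (by simp) (rowRepresents_winRow _ ?_) (represents_deucePolys h0 h1)⟩
    simp only [polyEval, deuceDen]
    push_cast
    ring
  | succ m ih =>
    exact RowRepresents.scanRow h0.le h1 hm (Or.inl m.succ_ne_zero) (by simp) (ih (by omega))
      (by simp [Represents, ServerPolys.const, needVals, polyEval])

theorem polyEval_advantagePoly (h0 : 0 < q) (h1 : q < 1) :
    serveSum q ^ 2 * polyEval q advantagePoly =
      serveSum q ^ 22 * (2 * deuceDen q) * soAdv 11 (1 - q) (1 - q) := by
  obtain ⟨-, h2, -, h4⟩ := (rowRepresents_polyRow h0 h1 (m := 10) le_rfl).getD (i := 10)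
    (by simp) (ServerPolys.const [])
  simp only [needVals, serverVals, Nat.reduceAdd, Nat.reduceSub, OfNat.ofNat_ne_zero,
    if_false] at h2 h4
  simp only [advantagePoly, polyEval_polyAdd, polyEval_polySmul, soAdv, Int.cast_neg,
    Int.cast_one]
  linear_combination h2 - h4

end Table

theorem polyMobius_advantagePoly_neg :
    ((polyMobius 660 459 1000 advantagePoly).1 ≠ []) ∧
      ∀ a ∈ (polyMobius 660 459 1000 advantagePoly).1, a < 0 := by
  decide +kernel

/-- For every `x ∈ [0.34, 0.54]`, `f_11(x, x) < 0`: in a side-out scoring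
game to 11 between evenly matched teams with serve-win probability in `[0.34, 0.54]`,
the first-serving team has a strictly smaller probability of winning. -/
theorem soAdv_eleven_neg (x : ℝ) (hx : x ∈ Set.Icc (0.34 : ℝ) 0.54) :
    soAdv 11 x x < 0 := by
  obtain ⟨q, rfl⟩ : ∃ q, x = 1 - q := ⟨1 - x, by ring⟩
  obtain ⟨hx1, hx2⟩ := hx
  norm_num at hx1 hx2
  have hq0 : 0 < q := by linarith
  have hq1 : q < 1 := by linarith
  have hd : 0 < 1000 * q - 459 := by linarith
  obtain ⟨t, ht⟩ : ∃ t, t = (660 - 1000 * q) / (1000 * q - 459) := ⟨_, rfl⟩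
  have ht0 : 0 ≤ t := ht ▸ div_nonneg (by linarith) hd.le
  have hmob : (((1000 : ℤ) : ℝ) + (1000 : ℤ) * t) * q = (660 : ℤ) + (459 : ℤ) * t := by
    push_cast
    linear_combination (eq_div_iff hd.ne').1 ht
  have hneg := polyEval_neg ht0 polyMobius_advantagePoly_neg.1 polyMobius_advantagePoly_neg.2
  rw [(polyEval_polyMobius hmob advantagePoly).2] at hneg
  have hP : polyEval q advantagePoly < 0 :=
    (pos_iff_neg_of_mul_neg hneg).1 (by push_cast; positivity)
  have hS := serveSum_pos hq0
  have hadv := polyEval_advantagePoly hq0 hq1 ▸ mul_neg_of_pos_of_neg (pow_pos hS 2) hP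
  exact (pos_iff_neg_of_mul_neg hadv).1
    (mul_pos (pow_pos hS 22) (mul_pos two_pos (deuceDen_pos hq0 hq1)))
end
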